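/- Let w, w′ ∈ W have disjoint supports. Then for every v ∈ W, one has v ≤ ww′ if and only if there exist v₁ ≤ w and v₂ ≤ w′ with v = v₁·v₂; moreover such v₁, v₂ are unique and satisfy l(v₁v₂) = l(v₁) + l(v₂). -/

import Mathlib

variable {B : Type*} {W : Type*} [Group W] {M : CoxeterMatrix B}

/-- The Bruhat order on `W`: `v ≤ w` iff some (equivalently, every) reduced expression
of `w` has a subsequence with product `v`. -/
def bruhatLE (cs : CoxeterSystem M W) (v w : W) : Prop :=
  ∃ ω : List B, cs.wordProd ω = w ∧ ω.length = cs.length w ∧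
    ∃ ω' : List B, ω'.Sublist ω ∧ cs.wordProd ω' = v

/-- The support of `w ∈ W`: the set of (indices of) simple reflections `s` with
`s ≤ w` in the Bruhat order. -/
def bSupport (cs : CoxeterSystem M W) (w : W) : Set B :=
  {i | bruhatLE cs (cs.simple i) w}

theorem Function.End.mul_apply {α : Type*} (f g : Function.End α) (a : α) :
    (f * g) a = f (g a) := rfl

namespace CoxeterSystem

open Classical in
/-- The action of the simple reflection `s i` on `W × ZMod 2`: conjugation on `W`, together with
a change of sign exactly at `s i`. -/
noncomputable def signedConj (cs : CoxeterSystem M W) (i : B) : Function.End (W × ZMod 2) :=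
  fun p => (cs.simple i * p.1 * cs.simple i, p.2 + if p.1 = cs.simple i then 1 else 0)

open Classical in
theorem signedConj_mul_pow_apply (cs : CoxeterSystem M W) (i j : B) (n : ℕ) (t : W) (e : ZMod 2) :
    ((cs.signedConj i * cs.signedConj j) ^ n) (t, e) =
      ((cs.simple i * cs.simple j) ^ n * t * (cs.simple j * cs.simple i) ^ n,
        e + ∑ k ∈ Finset.range (2 * n),
          if t = (cs.simple j * cs.simple i) ^ k * cs.simple j then 1 else 0) := by
  induction n with
  | zero => simp [Function.End.one_def]
  | succ n ih =>
    have hinv : (cs.simple i * cs.simple j) ^ n = ((cs.simple j * cs.simple i) ^ n)⁻¹ := by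
      rw [← inv_pow]; simp
    have hconj : cs.simple j * (cs.simple i * cs.simple j) ^ n =
        (cs.simple j * cs.simple i) ^ n * cs.simple j :=
      (show SemiconjBy (cs.simple j) (cs.simple i * cs.simple j) (cs.simple j * cs.simple i) by
        simp [SemiconjBy, mul_assoc]).pow_right n
    have h₁ : ∀ r : W, (cs.simple i * cs.simple j) ^ n * t * (cs.simple j * cs.simple i) ^ n = r ↔
        t = (cs.simple j * cs.simple i) ^ n * r * (cs.simple i * cs.simple j) ^ n := by
      intro r
      rw [hinv]
      constructor
      · rintro rfl; group
      · rintro rfl; group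
    have h₂ : (cs.simple i * cs.simple j) ^ n * t * (cs.simple j * cs.simple i) ^ n =
        cs.simple j ↔ t = (cs.simple j * cs.simple i) ^ (2 * n) * cs.simple j := by
      rw [h₁, mul_assoc, hconj, ← mul_assoc, ← pow_add, two_mul]
    have h₃ : cs.simple j * ((cs.simple i * cs.simple j) ^ n * t *
          (cs.simple j * cs.simple i) ^ n) * cs.simple j = cs.simple i ↔
        t = (cs.simple j * cs.simple i) ^ (2 * n + 1) * cs.simple j := by
      have h₄ : ∀ x : W, cs.simple j * x * cs.simple j = cs.simple i ↔
          x = cs.simple j * cs.simple i * cs.simple j := by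
        intro x
        constructor
        · intro h; rw [← h]; simp [mul_assoc]
        · rintro rfl; simp [mul_assoc]
      rw [h₄, h₁, mul_assoc, mul_assoc _ (cs.simple j), hconj, ← mul_assoc, ← mul_assoc,
        ← pow_succ, ← pow_add]
      congr! 3
      omega
    rw [pow_succ', Function.End.mul_apply, ih, Function.End.mul_apply]
    simp only [signedConj, h₂, h₃]
    refine Prod.ext ?_ ?_
    · simp only [pow_succ' (cs.simple i * cs.simple j), pow_succ (cs.simple j * cs.simple i),
        mul_assoc]
    · simp only [mul_add, mul_one, Finset.sum_range_succ, add_assoc]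

theorem isLiftable_signedConj (cs : CoxeterSystem M W) : M.IsLiftable cs.signedConj := by
  classical
  intro i j
  funext ⟨t, e⟩
  rw [signedConj_mul_pow_apply, cs.simple_mul_simple_pow, cs.simple_mul_simple_pow', two_mul,
    Finset.sum_range_add]
  simp only [pow_add, cs.simple_mul_simple_pow', one_mul, CharTwo.add_self_eq_zero, mul_one,
    add_zero]
  rfl

/-- The parity of the number of occurrences of `t` in the right inversion sequence of any word
for `w`. -/
noncomputable def inversionParity (cs : CoxeterSystem M W) (w t : W) : ZMod 2 :=
  (cs.lift ⟨cs.signedConj, cs.isLiftable_signedConj⟩ w (t, 0)).2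

theorem lift_signedConj_apply (cs : CoxeterSystem M W) (w t : W) (e : ZMod 2) :
    cs.lift ⟨cs.signedConj, cs.isLiftable_signedConj⟩ w (t, e) =
      (w * t * w⁻¹, e + cs.inversionParity w t) := by
  unfold inversionParity
  induction w using cs.simple_induction_left generalizing e with
  | one => simp [Function.End.one_def]
  | mul_simple_left w i ih =>
    simp only [map_mul, Function.End.mul_apply, lift_apply_simple]
    rw [ih e, ih 0]
    simp [signedConj, mul_assoc, add_assoc]

theorem inversionParity_mul (cs : CoxeterSystem M W) (x y t : W) :
    cs.inversionParity (x * y) t =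
      cs.inversionParity y t + cs.inversionParity x (y * t * y⁻¹) := by
  have h := congrArg Prod.snd (cs.lift_signedConj_apply (x * y) t 0)
  rw [map_mul, Function.End.mul_apply, lift_signedConj_apply,
    lift_signedConj_apply] at h
  simpa using h.symm

@[simp]
theorem inversionParity_one (cs : CoxeterSystem M W) (t : W) : cs.inversionParity 1 t = 0 := by
  simp [inversionParity, Function.End.one_def]

open Classical in
theorem inversionParity_simple (cs : CoxeterSystem M W) (i : B) (t : W) :
    cs.inversionParity (cs.simple i) t = if t = cs.simple i then 1 else 0 := by
  simp [inversionParity, signedConj]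

theorem IsReflection.inversionParity_self {cs : CoxeterSystem M W} {t : W}
    (ht : cs.IsReflection t) : cs.inversionParity t t = 1 := by
  obtain ⟨u, i, rfl⟩ := ht
  have h := cs.inversionParity_mul u u⁻¹ (u * cs.simple i * u⁻¹)
  have e : u⁻¹ * (u * cs.simple i * u⁻¹) * u⁻¹⁻¹ = cs.simple i := by group
  rw [mul_inv_cancel, inversionParity_one, e] at h
  rw [inversionParity_mul, e, inversionParity_mul, inversionParity_simple]
  simp only [mul_inv_cancel_right, if_true]
  linear_combination -h

theorem exists_sublist_of_inversionParity_eq_one (cs : CoxeterSystem M W) (ω : List B) {t : W}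
    (h : cs.inversionParity (cs.wordProd ω) t = 1) :
    ∃ ω' : List B, ω'.Sublist ω ∧ ω'.length + 1 = ω.length ∧
      cs.wordProd ω' = cs.wordProd ω * t := by
  induction ω with
  | nil => simp at h
  | cons i ω ih =>
    rw [wordProd_cons, inversionParity_mul, inversionParity_simple] at h
    split_ifs at h with hi
    · refine ⟨ω, List.sublist_cons_self i ω, rfl, ?_⟩
      rw [wordProd_cons, ← hi]
      have h' := cs.simple_mul_simple_cancel_left (w := cs.wordProd ω) i
      rw [← mul_inv_eq_iff_eq_mul.mp hi] at h'
      simpa only [hi, mul_assoc] using h'.symm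
    · obtain ⟨ω', hs, hl, hp⟩ := ih (by simpa using h)
      exact ⟨i :: ω', hs.cons_cons i, by simpa using hl, by
        rw [wordProd_cons, wordProd_cons, hp, mul_assoc]⟩

theorem length_mul_lt_of_inversionParity_eq_one (cs : CoxeterSystem M W) {w t : W}
    (h : cs.inversionParity w t = 1) : cs.length (w * t) < cs.length w := by
  obtain ⟨ω, hω, rfl⟩ := cs.exists_isReduced w
  obtain ⟨ω', -, hl, hp⟩ := cs.exists_sublist_of_inversionParity_eq_one ω h
  rw [← hp, hω.eq, ← hl]
  exact Nat.lt_succ_of_le (cs.length_wordProd_le ω')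

theorem IsRightInversion.inversionParity_eq_one {cs : CoxeterSystem M W} {w t : W}
    (h : cs.IsRightInversion w t) : cs.inversionParity w t = 1 := by
  obtain ⟨ht, hlt⟩ := h
  by_contra hne
  have h0 : cs.inversionParity w t = 0 := by
    generalize cs.inversionParity w t = x at hne
    revert x; decide
  have h1 : cs.inversionParity (w * t) t = 1 := by
    rw [inversionParity_mul, mul_inv_cancel_right, h0, ht.inversionParity_self, add_zero]
  have := cs.length_mul_lt_of_inversionParity_eq_one h1
  rw [mul_assoc, ht.mul_self, mul_one] at this
  omega

/-- The strong exchange condition. -/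
theorem IsRightInversion.exists_sublist {cs : CoxeterSystem M W} {ω : List B} {t : W}
    (h : cs.IsRightInversion (cs.wordProd ω) t) :
    ∃ ω' : List B, ω'.Sublist ω ∧ ω'.length + 1 = ω.length ∧
      cs.wordProd ω' = cs.wordProd ω * t :=
  cs.exists_sublist_of_inversionParity_eq_one ω h.inversionParity_eq_one

/-- The exchange condition for left descents. -/
theorem IsLeftDescent.exists_sublist {cs : CoxeterSystem M W} {ω : List B} {i : B}
    (h : cs.IsLeftDescent (cs.wordProd ω) i) :
    ∃ ω' : List B, ω'.Sublist ω ∧ ω'.length + 1 = ω.length ∧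
      cs.wordProd ω' = cs.simple i * cs.wordProd ω := by
  have e : cs.wordProd ω * ((cs.wordProd ω)⁻¹ * cs.simple i * cs.wordProd ω) =
      cs.simple i * cs.wordProd ω := by group
  have hr : cs.IsRightInversion (cs.wordProd ω)
      ((cs.wordProd ω)⁻¹ * cs.simple i * cs.wordProd ω) :=
    ⟨by simpa using (cs.isReflection_simple i).conj (cs.wordProd ω)⁻¹, by rw [e]; exact h⟩
  simpa only [e] using hr.exists_sublist

/-- The deletion property: every word contains a reduced subword with the same product. -/
theorem exists_isReduced_sublist (cs : CoxeterSystem M W) (ω : List B) :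
    ∃ ω' : List B, ω'.Sublist ω ∧ cs.IsReduced ω' ∧ cs.wordProd ω' = cs.wordProd ω := by
  induction ω with
  | nil => exact ⟨[], List.Sublist.refl _, by simp [IsReduced], rfl⟩
  | cons i ω ih =>
    obtain ⟨τ, hs, hr, hp⟩ := ih
    by_cases hd : cs.IsLeftDescent (cs.wordProd τ) i
    · obtain ⟨τ', hs', hl, hp'⟩ := hd.exists_sublist
      refine ⟨τ', (hs'.trans hs).trans (List.sublist_cons_self i ω), ?_, ?_⟩
      · have := cs.isLeftDescent_iff.mp hd
        rw [hr.eq, ← hp'] at this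
        unfold IsReduced
        omega
      · rw [hp', hp, wordProd_cons]
    · refine ⟨i :: τ, hs.cons_cons i, ?_, by rw [wordProd_cons, wordProd_cons, hp]⟩
      have := cs.not_isLeftDescent_iff.mp hd
      rw [IsReduced, wordProd_cons, this, hr.eq, List.length_cons]

/-- An edge of the Bruhat graph. -/
def BruhatEdge (cs : CoxeterSystem M W) (u w : W) : Prop :=
  ∃ t, cs.IsReflection t ∧ w = u * t ∧ cs.length u < cs.length w

theorem BruhatEdge.simple_mul {cs : CoxeterSystem M W} {u x : W} (h : cs.BruhatEdge u x) (i : B) :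
    cs.BruhatEdge (cs.simple i * u) (cs.simple i * x) ∨ cs.simple i * u = x := by
  obtain ⟨t, ht, rfl, hlt⟩ := h
  by_cases hc : cs.length (cs.simple i * u) < cs.length (cs.simple i * (u * t))
  · exact .inl ⟨t, ht, (mul_assoc _ _ _).symm, hc⟩
  right
  have hr : cs.IsRightInversion (cs.simple i * (cs.simple i * (u * t))) t := by
    refine ⟨ht, ?_⟩
    rwa [simple_mul_simple_cancel_left, mul_assoc, ht.mul_self, mul_one]
  have hpar := hr.inversionParity_eq_one
  rw [inversionParity_mul, inversionParity_simple] at hpar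
  split_ifs at hpar with hi
  · rw [mul_inv_eq_iff_eq_mul] at hi
    simpa [mul_assoc, ht.mul_self] using hi
  · rw [add_zero] at hpar
    have := cs.length_mul_lt_of_inversionParity_eq_one hpar
    rw [mul_assoc, mul_assoc, ht.mul_self, mul_one] at this
    exact absurd this hc

theorem IsReduced.bruhatEdge_cons {cs : CoxeterSystem M W} {i : B} {ω : List B}
    (h : cs.IsReduced (i :: ω)) :
    cs.BruhatEdge (cs.wordProd ω) (cs.wordProd (i :: ω)) := by
  refine ⟨(cs.wordProd ω)⁻¹ * cs.simple i * cs.wordProd ω,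
    by simpa using (cs.isReflection_simple i).conj (cs.wordProd ω)⁻¹,
    by rw [wordProd_cons]; group, ?_⟩
  rw [h.eq]
  exact Nat.lt_succ_of_le (cs.length_wordProd_le ω)

theorem simple_mul_reflTransGen_bruhatEdge (cs : CoxeterSystem M W) {u x : W}
    (h : Relation.ReflTransGen cs.BruhatEdge u x) (i : B) :
    Relation.ReflTransGen cs.BruhatEdge (cs.simple i * u) (cs.simple i * x) ∨
      Relation.ReflTransGen cs.BruhatEdge (cs.simple i * u) x := by
  induction h using Relation.ReflTransGen.head_induction_on with
  | refl => exact .inl .refl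
  | head h₁ h₂ ih =>
    rcases h₁.simple_mul i with h | h
    · exact ih.imp (.head h) (.head h)
    · exact .inr (h ▸ h₂)

theorem IsReduced.reflTransGen_bruhatEdge_of_sublist {cs : CoxeterSystem M W} {ω ω' : List B}
    (hω : cs.IsReduced ω) (h : ω'.Sublist ω) :
    Relation.ReflTransGen cs.BruhatEdge (cs.wordProd ω') (cs.wordProd ω) := by
  induction h with
  | slnil => exact .refl
  | @cons ω' ω i h ih =>
    exact (ih (hω.drop 1)).tail (hω.bruhatEdge_cons)
  | @cons_cons ω' ω i h ih =>
    rw [wordProd_cons, wordProd_cons]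
    rcases cs.simple_mul_reflTransGen_bruhatEdge (ih (hω.drop 1)) i with h | h
    · exact h
    · rw [← wordProd_cons cs i ω]
      exact h.tail hω.bruhatEdge_cons

theorem IsReduced.exists_sublist_of_reflTransGen_bruhatEdge {cs : CoxeterSystem M W}
    {ω : List B} (hω : cs.IsReduced ω) {v : W}
    (h : Relation.ReflTransGen cs.BruhatEdge v (cs.wordProd ω)) :
    ∃ ω' : List B, ω'.Sublist ω ∧ cs.wordProd ω' = v := by
  generalize hw : cs.wordProd ω = w at h
  induction h generalizing ω with
  | refl => exact ⟨ω, List.Sublist.refl _, hw⟩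
  | @tail y w h₁ h₂ ih =>
    obtain ⟨t, ht, rfl, hlt⟩ := h₂
    have hr : cs.IsRightInversion (cs.wordProd ω) t := by
      refine ⟨ht, ?_⟩
      rwa [hw, mul_assoc, ht.mul_self, mul_one]
    obtain ⟨τ, hs, -, hp⟩ := hr.exists_sublist
    rw [hw, mul_assoc, ht.mul_self, mul_one] at hp
    obtain ⟨τ', hs', hτ', hp'⟩ := cs.exists_isReduced_sublist τ
    obtain ⟨ω', hs'', hv⟩ := ih hτ' (hp'.trans hp)
    exact ⟨ω', (hs''.trans hs').trans hs, hv⟩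

/-- The subword property: the Bruhat order can be tested on any reduced word. -/
theorem IsReduced.bruhatLE_wordProd_iff {cs : CoxeterSystem M W} {ω : List B}
    (hω : cs.IsReduced ω) {v : W} :
    bruhatLE cs v (cs.wordProd ω) ↔ ∃ ω' : List B, ω'.Sublist ω ∧ cs.wordProd ω' = v := by
  constructor
  · rintro ⟨τ, hp, hl, τ', hs, rfl⟩
    have hτ : cs.IsReduced τ := by rw [IsReduced, hp, hl]
    exact hω.exists_sublist_of_reflTransGen_bruhatEdge
      (hp ▸ hτ.reflTransGen_bruhatEdge_of_sublist hs)
  · exact fun h => ⟨ω, rfl, hω.eq.symm, h⟩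

/-- The standard parabolic subgroup generated by the simple reflections indexed by `I`. -/
def parabolic (cs : CoxeterSystem M W) (I : Set B) : Subgroup W :=
  Subgroup.closure (cs.simple '' I)

theorem wordProd_mem_parabolic (cs : CoxeterSystem M W) {I : Set B} {ω : List B}
    (h : ∀ i ∈ ω, i ∈ I) : cs.wordProd ω ∈ cs.parabolic I := by
  refine Subgroup.list_prod_mem _ fun x hx => ?_
  obtain ⟨i, hi, rfl⟩ := List.mem_map.mp hx
  exact Subgroup.subset_closure ⟨i, h i hi, rfl⟩

theorem exists_isReduced_of_mem_parabolic (cs : CoxeterSystem M W) {I : Set B} {x : W}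
    (hx : x ∈ cs.parabolic I) :
    ∃ ω : List B, cs.IsReduced ω ∧ (∀ i ∈ ω, i ∈ I) ∧ cs.wordProd ω = x := by
  suffices h : ∃ ω : List B, (∀ i ∈ ω, i ∈ I) ∧ cs.wordProd ω = x by
    obtain ⟨ω, hI, rfl⟩ := h
    obtain ⟨ω', hs, hr, hp⟩ := cs.exists_isReduced_sublist ω
    exact ⟨ω', hr, fun i hi => hI i (hs.subset hi), hp⟩
  induction hx using Subgroup.closure_induction with
  | mem x hx =>
    obtain ⟨i, hi, rfl⟩ := hx
    exact ⟨[i], by simpa using hi, by simp⟩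
  | one => exact ⟨[], by simp, by simp⟩
  | mul x y _ _ hx hy =>
    obtain ⟨ω, hω, rfl⟩ := hx
    obtain ⟨τ, hτ, rfl⟩ := hy
    exact ⟨ω ++ τ, fun i hi => (List.mem_append.mp hi).elim (hω i) (hτ i),
      cs.wordProd_append ω τ⟩
  | inv x _ hx =>
    obtain ⟨ω, hω, rfl⟩ := hx
    exact ⟨ω.reverse, by simpa using hω, by simp⟩

theorem disjoint_parabolic (cs : CoxeterSystem M W) {I J : Set B}
    (h : Disjoint (cs.simple '' I) (cs.simple '' J)) :
    Disjoint (cs.parabolic I) (cs.parabolic J) := by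
  rw [Subgroup.disjoint_def]
  intro x hI hJ
  obtain ⟨ω, hω, hωI, rfl⟩ := cs.exists_isReduced_of_mem_parabolic hI
  obtain ⟨τ, hτ, hτJ, hp⟩ := cs.exists_isReduced_of_mem_parabolic hJ
  cases τ with
  | nil => exact hp.symm
  | cons j τ =>
    exfalso
    have hd : cs.IsLeftDescent (cs.wordProd ω) j := by
      rw [← hp, IsLeftDescent, hτ.eq, wordProd_cons, simple_mul_simple_cancel_left]
      exact Nat.lt_succ_of_le (cs.length_wordProd_le τ)
    obtain ⟨ω', hs, -, hω'⟩ := hd.exists_sublist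
    have hj : cs.simple j ∈ cs.parabolic I := by
      rw [← mul_inv_eq_iff_eq_mul.mpr hω']
      exact mul_mem (cs.wordProd_mem_parabolic fun i hi => hωI i (hs.subset hi)) (inv_mem hI)
    obtain ⟨σ, hσ, hσI, hσj⟩ := cs.exists_isReduced_of_mem_parabolic hj
    have hl : σ.length = 1 := by rw [← hσ.eq, hσj, length_simple]
    obtain ⟨i, rfl⟩ := List.length_eq_one_iff.mp hl
    exact Set.disjoint_left.mp h ⟨i, hσI i (by simp), by simpa using hσj⟩
      ⟨j, hτJ j (by simp), rfl⟩

theorem isReduced_append_of_disjoint (cs : CoxeterSystem M W) {I J : Set B}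
    (h : Disjoint (cs.simple '' I) (cs.simple '' J)) {ω τ : List B}
    (hω : cs.IsReduced ω) (hτ : cs.IsReduced τ) (hωI : ∀ i ∈ ω, i ∈ I) (hτJ : ∀ j ∈ τ, j ∈ J) :
    cs.IsReduced (ω ++ τ) := by
  induction ω with
  | nil => exact hτ
  | cons i ω ih =>
    have hωI' : ∀ i ∈ ω, i ∈ I := fun k hk => hωI k (List.mem_cons_of_mem i hk)
    have ih := ih (hω.drop 1) hωI'
    suffices hd : ¬ cs.IsLeftDescent (cs.wordProd (ω ++ τ)) i by
      rw [List.cons_append, IsReduced, wordProd_cons, cs.not_isLeftDescent_iff.mp hd, ih.eq,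
        List.length_cons]
    intro hd
    obtain ⟨σ, hs, hl, hp⟩ := hd.exists_sublist
    obtain ⟨ω', τ', rfl, hω', hτ'⟩ := List.sublist_append_iff.mp hs
    rw [wordProd_append, wordProd_append, ← mul_assoc, ← wordProd_cons] at hp
    have hquot : (cs.wordProd (i :: ω))⁻¹ * cs.wordProd ω' =
        cs.wordProd τ * (cs.wordProd τ')⁻¹ := by
      rw [inv_mul_eq_iff_eq_mul, ← mul_assoc, eq_mul_inv_iff_mul_eq, hp]
    have hone : (cs.wordProd (i :: ω))⁻¹ * cs.wordProd ω' = 1 := by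
      refine Subgroup.disjoint_def.mp (cs.disjoint_parabolic h) ?_ ?_
      · exact mul_mem (inv_mem (cs.wordProd_mem_parabolic hωI))
          (cs.wordProd_mem_parabolic fun k hk => hωI' k (hω'.subset hk))
      · rw [hquot]
        exact mul_mem (cs.wordProd_mem_parabolic hτJ)
          (inv_mem (cs.wordProd_mem_parabolic fun k hk => hτJ k (hτ'.subset hk)))
    have h₁ := cs.length_wordProd_le ω'
    rw [← inv_mul_eq_one.mp hone, hω.eq, List.length_cons] at h₁
    have h₂ := hω'.length_le
    omega

theorem length_mul_of_mem_parabolic (cs : CoxeterSystem M W) {I J : Set B}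
    (h : Disjoint (cs.simple '' I) (cs.simple '' J)) {x y : W}
    (hx : x ∈ cs.parabolic I) (hy : y ∈ cs.parabolic J) :
    cs.length (x * y) = cs.length x + cs.length y := by
  obtain ⟨ω, hω, hωI, rfl⟩ := cs.exists_isReduced_of_mem_parabolic hx
  obtain ⟨τ, hτ, hτJ, rfl⟩ := cs.exists_isReduced_of_mem_parabolic hy
  rw [← wordProd_append, (cs.isReduced_append_of_disjoint h hω hτ hωI hτJ).eq, hω.eq, hτ.eq,
    List.length_append]

theorem mul_eq_mul_iff_of_mem_parabolic (cs : CoxeterSystem M W) {I J : Set B}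
    (h : Disjoint (cs.simple '' I) (cs.simple '' J)) {x x' y y' : W}
    (hx : x ∈ cs.parabolic I) (hx' : x' ∈ cs.parabolic I)
    (hy : y ∈ cs.parabolic J) (hy' : y' ∈ cs.parabolic J) :
    x * y = x' * y' ↔ x = x' ∧ y = y' := by
  refine ⟨fun he => ?_, by rintro ⟨rfl, rfl⟩; rfl⟩
  have hquot : x'⁻¹ * x = y' * y⁻¹ := by
    rw [inv_mul_eq_iff_eq_mul, ← mul_assoc, eq_mul_inv_iff_mul_eq, he]
  have hone : x'⁻¹ * x = 1 :=
    Subgroup.disjoint_def.mp (cs.disjoint_parabolic h) (mul_mem (inv_mem hx') hx)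
      (hquot ▸ mul_mem hy' (inv_mem hy))
  obtain rfl := inv_mul_eq_one.mp hone
  exact ⟨rfl, mul_left_cancel he⟩

theorem IsReduced.subset_bSupport {cs : CoxeterSystem M W} {ω : List B} (hω : cs.IsReduced ω) :
    ∀ i ∈ ω, i ∈ bSupport cs (cs.wordProd ω) := fun i hi =>
  ⟨ω, rfl, hω.eq.symm, [i], List.singleton_sublist.mpr hi, by simp⟩

theorem mem_parabolic_bSupport_of_bruhatLE {cs : CoxeterSystem M W} {v w : W}
    (h : bruhatLE cs v w) : v ∈ cs.parabolic (bSupport cs w) := by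
  obtain ⟨ω, rfl, hl, τ, hs, rfl⟩ := h
  exact cs.wordProd_mem_parabolic fun i hi =>
    IsReduced.subset_bSupport (cs := cs) hl.symm i (hs.subset hi)

theorem disjoint_simple_image_bSupport {cs : CoxeterSystem M W} {w w' : W}
    (h : Disjoint (bSupport cs w) (bSupport cs w')) :
    Disjoint (cs.simple '' bSupport cs w) (cs.simple '' bSupport cs w') := by
  rw [Set.disjoint_left]
  rintro _ ⟨i, hi, rfl⟩ ⟨j, hj, hij⟩
  refine Set.disjoint_left.mp h hi ?_
  rw [bSupport, Set.mem_ofPred_eq] at hj ⊢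
  exact hij ▸ hj

theorem bruhatLE_mul_iff_of_disjoint_bSupport {cs : CoxeterSystem M W} {w w' : W}
    (h : Disjoint (bSupport cs w) (bSupport cs w')) {v : W} :
    bruhatLE cs v (w * w') ↔ ∃ v₁ v₂ : W, bruhatLE cs v₁ w ∧ bruhatLE cs v₂ w' ∧ v = v₁ * v₂ := by
  obtain ⟨ω, hω, rfl⟩ := cs.exists_isReduced w
  obtain ⟨τ, hτ, rfl⟩ := cs.exists_isReduced w'
  have hr := cs.isReduced_append_of_disjoint (disjoint_simple_image_bSupport h) hω hτ
    hω.subset_bSupport hτ.subset_bSupport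
  rw [← wordProd_append, hr.bruhatLE_wordProd_iff]
  simp only [hω.bruhatLE_wordProd_iff, hτ.bruhatLE_wordProd_iff, List.sublist_append_iff]
  constructor
  · rintro ⟨_, ⟨ω', τ', rfl, hω', hτ'⟩, rfl⟩
    exact ⟨_, _, ⟨ω', hω', rfl⟩, ⟨τ', hτ', rfl⟩, cs.wordProd_append ω' τ'⟩
  · rintro ⟨_, _, ⟨ω', hω', rfl⟩, ⟨τ', hτ', rfl⟩, rfl⟩
    exact ⟨_, ⟨ω', τ', rfl, hω', hτ'⟩, cs.wordProd_append ω' τ'⟩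

end CoxeterSystem

/-- If `w, w' ∈ W` have disjoint supports, then `v ≤ ww'` iff
`v = v₁·v₂` with `v₁ ≤ w` and `v₂ ≤ w'`; moreover such `v₁, v₂` are unique and satisfy
`l(v₁v₂) = l(v₁) + l(v₂)`. -/
theorem stmt13 [Finite W] (cs : CoxeterSystem M W) (w w' : W)
    (h : Disjoint (bSupport cs w) (bSupport cs w')) :
    (∀ v : W, bruhatLE cs v (w * w') ↔
      ∃ v₁ v₂ : W, bruhatLE cs v₁ w ∧ bruhatLE cs v₂ w' ∧ v = v₁ * v₂) ∧
    (∀ v₁ v₂ u₁ u₂ : W, bruhatLE cs v₁ w → bruhatLE cs v₂ w' →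
      bruhatLE cs u₁ w → bruhatLE cs u₂ w' → v₁ * v₂ = u₁ * u₂ → v₁ = u₁ ∧ v₂ = u₂) ∧
    (∀ v₁ v₂ : W, bruhatLE cs v₁ w → bruhatLE cs v₂ w' →
      cs.length (v₁ * v₂) = cs.length v₁ + cs.length v₂) := by
  have hd := CoxeterSystem.disjoint_simple_image_bSupport h
  refine ⟨fun v => CoxeterSystem.bruhatLE_mul_iff_of_disjoint_bSupport h, ?_, ?_⟩
  · intro v₁ v₂ u₁ u₂ hv₁ hv₂ hu₁ hu₂
    exact (cs.mul_eq_mul_iff_of_mem_parabolic hd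
      (CoxeterSystem.mem_parabolic_bSupport_of_bruhatLE hv₁)
      (CoxeterSystem.mem_parabolic_bSupport_of_bruhatLE hu₁)
      (CoxeterSystem.mem_parabolic_bSupport_of_bruhatLE hv₂)
      (CoxeterSystem.mem_parabolic_bSupport_of_bruhatLE hu₂)).mp
  · intro v₁ v₂ hv₁ hv₂
    exact cs.length_mul_of_mem_parabolic hd
      (CoxeterSystem.mem_parabolic_bSupport_of_bruhatLE hv₁)
      (CoxeterSystem.mem_parabolic_bSupport_of_bruhatLE hv₂)
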